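/- In R = A[[h]], define S := Σ_{n≥0} binom(1/2,n) h^{2n} b₊^{2n}, T := h·b₊ + S, T⁻¹ := -h·b₊ + S (two-sided inverses), and set E := e, H := S·h̄, F := f + (h/4)(T-1)(T+1)⁻¹e - (h/2)(T-1)(T+1)⁻¹e·h̄, where (T+1)⁻¹ is the inverse of T+1 in R (which exists since T+1 has constant term 2). Then the super-Jordanian U_h(osp(1|2)) relations hold: HE - EH = (1/2)(T+T⁻¹)E; HF - FH = -(1/4)(T+T⁻¹)F - (1/4)F(T+T⁻¹); EF + FE = -H; HT^{±1} - T^{±1}H = T^{±2} - 1; 2hE² = T - T⁻¹; and T^{±1}F - FT^{±1} = ±h·T^{±1}E. -/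

import Mathlib

noncomputable section

/-- The generalized binomial coefficient `α(α-1)⋯(α-n+1)/n!`. -/
def qbinom (α : ℚ) (n : ℕ) : ℚ :=
  (∏ i ∈ Finset.range n, (α - (i : ℚ))) / (n.factorial : ℚ)

/-- `S := Σ_{n≥0} binom(1/2,n) h^{2n} u^{2n}` in `A[[h]]`. -/
def sqrtSer {A : Type*} [Ring A] [Algebra ℂ A] (u : A) : PowerSeries A :=
  PowerSeries.mk fun m =>
    if m % 2 = 0 then ((qbinom (1/2) (m / 2) : ℚ) : ℂ) • u ^ m else 0

/-- `T := h·u + S`. -/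
def Tser {A : Type*} [Ring A] [Algebra ℂ A] (u : A) : PowerSeries A :=
  PowerSeries.X * PowerSeries.C u + sqrtSer u

/-- `T⁻¹ := -h·u + S`. -/
def Tinvser {A : Type*} [Ring A] [Algebra ℂ A] (u : A) : PowerSeries A :=
  -(PowerSeries.X * PowerSeries.C u) + sqrtSer u

/-- The ring map `∑ aₙ Xⁿ ↦ ∑ aₙ uⁿ Xⁿ` from `ℂ⟦X⟧` to `A⟦X⟧`. -/
def scaleSer {A : Type*} [Ring A] [Algebra ℂ A] (u : A) (a : PowerSeries ℂ) : PowerSeries A :=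
  PowerSeries.mk fun n => PowerSeries.coeff n a • u ^ n

section PowerSeriesLemmas

variable {A : Type*} [Ring A] [Algebra ℂ A] (u : A)

lemma scaleSer_mul (a b : PowerSeries ℂ) :
    scaleSer u (a * b) = scaleSer u a * scaleSer u b := by
  ext n
  simp only [scaleSer, PowerSeries.coeff_mk, PowerSeries.coeff_mul, Finset.sum_smul]
  refine Finset.sum_congr rfl fun p hp => ?_
  rw [Finset.HasAntidiagonal.mem_antidiagonal] at hp
  rw [smul_mul_smul_comm, ← pow_add, hp]

lemma scaleSer_one : scaleSer u 1 = 1 := by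
  ext n
  by_cases hn : n = 0 <;> simp [scaleSer, PowerSeries.coeff_one, hn]

lemma scaleSer_one_add_X_sq :
    scaleSer u (1 + PowerSeries.X ^ 2) =
      1 + PowerSeries.X * PowerSeries.C u * (PowerSeries.X * PowerSeries.C u) := by
  have h : (PowerSeries.X * PowerSeries.C u * (PowerSeries.X * PowerSeries.C u) : PowerSeries A) =
      PowerSeries.C (u ^ 2) * PowerSeries.X ^ 2 := by
    rw [PowerSeries.X_mul, map_pow, sq, sq, mul_assoc, ← mul_assoc PowerSeries.X,
      PowerSeries.X_mul]
    simp only [mul_assoc]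
  ext n
  rw [h]
  simp only [scaleSer, PowerSeries.coeff_mk, map_add, PowerSeries.coeff_one,
    PowerSeries.coeff_C_mul, PowerSeries.coeff_X_pow]
  by_cases h0 : n = 0
  · subst h0; simp
  · by_cases h2 : n = 2
    · subst h2; simp
    · simp [h0, h2]

lemma qbinom_eq_choose (r : ℚ) (n : ℕ) : qbinom r n = Ring.choose r n := by
  rw [qbinom, Ring.choose_eq_smul, ← Polynomial.aeval_eq_smeval, Polynomial.aeval_def,
    Polynomial.eval₂_eq_eval_map, descPochhammer_map, descPochhammer_eval_eq_prod_range,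
    smul_eq_mul, div_eq_inv_mul]

/-- The power series `(1 + X²) ^ r`. -/
def oneAddSqPow (r : ℚ) : PowerSeries ℂ :=
  PowerSeries.expand 2 two_ne_zero (PowerSeries.binomialSeries ℂ r)

lemma oneAddSqPow_add (r s : ℚ) :
    oneAddSqPow (r + s) = oneAddSqPow r * oneAddSqPow s := by
  simp [oneAddSqPow]

lemma sqrtSer_eq_scaleSer : sqrtSer u = scaleSer u (oneAddSqPow (1 / 2)) := by
  ext n
  simp only [sqrtSer, scaleSer, oneAddSqPow, PowerSeries.coeff_mk, PowerSeries.coeff_expand,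
    PowerSeries.binomialSeries_coeff, Nat.dvd_iff_mod_eq_zero, qbinom_eq_choose]
  split_ifs <;> simp [Algebra.smul_def]

lemma sqrtSer_mul_self :
    sqrtSer u * sqrtSer u =
      1 + PowerSeries.X * PowerSeries.C u * (PowerSeries.X * PowerSeries.C u) := by
  have h : oneAddSqPow 1 = 1 + PowerSeries.X ^ 2 := by
    simpa [oneAddSqPow] using congrArg (PowerSeries.expand 2 two_ne_zero)
      (PowerSeries.binomialSeries_nat (R := ℚ) (A := ℂ) 1)
  rw [← scaleSer_one_add_X_sq, ← h, sqrtSer_eq_scaleSer, ← scaleSer_mul, ← oneAddSqPow_add]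
  norm_num

lemma isUnit_sqrtSer : IsUnit (sqrtSer u) := by
  have h (r s : ℚ) (hrs : r + s = 0) :
      scaleSer u (oneAddSqPow r) * scaleSer u (oneAddSqPow s) = 1 := by
    rw [← scaleSer_mul, ← oneAddSqPow_add, hrs, oneAddSqPow, PowerSeries.binomialSeries_zero,
      map_one, scaleSer_one]
  rw [sqrtSer_eq_scaleSer]
  exact ⟨⟨_, scaleSer u (oneAddSqPow (-1 / 2)), h _ _ (by norm_num), h _ _ (by norm_num)⟩, rfl⟩

lemma commute_sqrtSer {u : A} {a : PowerSeries A} (h : Commute (PowerSeries.C u) a) :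
    Commute (sqrtSer u) a := by
  have hcoeff (n : ℕ) : u * PowerSeries.coeff n a = PowerSeries.coeff n a * u := by
    simpa using congrArg (PowerSeries.coeff n) h.eq
  ext n
  simp only [sqrtSer, PowerSeries.coeff_mul, PowerSeries.coeff_mk]
  rw [← Finset.Nat.sum_antidiagonal_swap]
  refine Finset.sum_congr rfl fun p _ => ?_
  simp only [Prod.fst_swap, Prod.snd_swap]
  split_ifs
  · exact (((show Commute u _ from hcoeff p.1).pow_left p.2).smul_left _).eq
  · simp

end PowerSeriesLemmas

section RingLemmas

variable {R : Type*} [Ring R]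

lemma mul_commutator_of_sq_eq (h2 : IsUnit (2 : R)) {S g a c : R} (hS : S * S = 1 + g * g)
    (hc : a * g - g * a = c) (hgc : g * c = c * g)
    (hcomm : S * (a * S - S * a) = (a * S - S * a) * S) :
    S * (a * S - S * a) = g * c := by
  apply h2.mul_left_cancel
  linear_combination (norm := noncomm_ring) hcomm + a * hS - hS * a + hc * g + g * hc - hgc

lemma mul_comm_of_inverse {a b w : R} (h : a * b = b * a) (hw : b * w = 1) (hw' : w * b = 1) :
    a * w = w * a := by
  linear_combination (norm := noncomm_ring) w * a * hw - hw' * (a * w) - w * h * w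

lemma mul_cayley {S g W : R} (hS : S * S = 1 + g * g) (hSg : S * g = g * S)
    (hW : (S + g + 1) * W = 1) : g * ((S + g - 1) * W) = S - 1 := by
  linear_combination (norm := noncomm_ring) (-hSg - hS) * W + (S - 1) * hW

lemma one_add_mul_cayley {S g W : R} (hS : S * S = 1 + g * g) (hSg : S * g = g * S)
    (hW : (S + g + 1) * W = 1) : (1 + S) * ((S + g - 1) * W) = g := by
  linear_combination (norm := noncomm_ring) (hSg + hS) * W + g * hW

lemma mul_commutator_cayley {S T W k : R} (hST : S * T = T * S)
    (hW : (T + 1) * W = 1) (hW' : W * (T + 1) = 1) (hkT : S * (k * T - T * k) = T * T - 1) :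
    S * (k * ((T - 1) * W) - (T - 1) * W * k) = 2 * ((T - 1) * W) := by
  have hSW : S * W = W * S :=
    mul_comm_of_inverse (by linear_combination (norm := noncomm_ring) hST) hW hW'
  have hSY : S * ((T - 1) * W) = (T - 1) * W * S := by
    linear_combination (norm := noncomm_ring) hST * W + (T - 1) * hSW
  have hY : (T - 1) * W * (T + 1) = T - 1 := by
    linear_combination (norm := noncomm_ring) (T - 1) * hW'
  generalize (T - 1) * W = Y at *
  have h : S * (k * Y - Y * k) * (T + 1) = 2 * Y * (T + 1) := by
    linear_combination (norm := noncomm_ring)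
      (S * k) * hY - S * hY * k + (1 - Y) * hkT - hSY * (k * T - T * k) - hY * (T - 1) - 2 * hY
  linear_combination (norm := noncomm_ring) h * W - (S * (k * Y - Y * k) - 2 * Y) * hW

section DeformedGenerators

variable {k e f S x p g Z : R}

lemma anticommutator_deformed (hke : k * e - e * k = e) (hef : e * f + f * e = -k)
    (hZe : Z * e = e * Z) (hZu : 4 * (Z * (e * e)) = S - 1) :
    e * (f + Z * e - 2 * (Z * e * k)) + (f + Z * e - 2 * (Z * e * k)) * e = -(S * k) := by
  linear_combination (norm := noncomm_ring)
    hef - hZe * e - hZu * k - 2 * (Z * e) * hke + 2 * hZe * e * k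

lemma commutator_deformed_group (hS : IsUnit S) {T : R} (hT : T = S + g)
    (hSe : S * e = e * S) (hge : g * e = e * g) (hxS : x * S = S * x)
    (hSZ : S * Z = Z * S) (hgZ : g * Z = Z * g)
    (hZg : 4 * (Z * g) = x * (S - 1))
    (hkT : S * (k * T - T * k) = T * T - 1) (hfT : S * (T * f - f * T) = x * (e * T))
    (hTT : T * T - 1 = 2 * (g * T)) :
    T * (f + Z * e - 2 * (Z * e * k)) - (f + Z * e - 2 * (Z * e * k)) * T = x * (T * e) := by
  have hTZ : T * Z = Z * T := by rw [hT]; linear_combination (norm := noncomm_ring) hSZ + hgZ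
  have hTe : T * e = e * T := by rw [hT]; linear_combination (norm := noncomm_ring) hSe + hge
  apply hS.mul_left_cancel
  linear_combination (norm := noncomm_ring) hfT + S * hTZ * e + S * Z * hTe
    - 2 * S * (hTZ * e + Z * hTe) * k + 2 * hSZ * e * (k * T - T * k)
    + 2 * Z * hSe * (k * T - T * k) + 2 * Z * e * hkT + 2 * Z * e * hTT - 4 * Z * hge * T
    + hZg * e * T + hxS * e * T - S * x * hTe

lemma commutator_deformed_cartan (hkf : k * f - f * k = -f) (hke : k * e - e * k = e)
    {q F : R} (hF : F = f + Z * e - 2 * (Z * e * k))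
    (hZq : Z + S * Z = q) (hkZ : S * (k * Z - Z * k) = 2 * Z)
    (hSF : S * F - F * S = 4 * (q * e)) :
    2 * (S * k * F - F * (S * k)) = -(S * F + F * S) := by
  have h : 2 * (S * (k * F - F * k)) = -2 * (S * F) + 4 * (q * e) - 8 * (q * e * k) := by
    rw [hF]
    linear_combination (norm := noncomm_ring) 2 * S * hkf + 2 * hkZ * e + 2 * S * Z * hke
      - 4 * hkZ * e * k - 4 * S * Z * hke * k + 4 * hZq * e - 8 * hZq * e * k
  linear_combination (norm := noncomm_ring) h + 2 * hSF * k - hSF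

end DeformedGenerators

lemma superJordanian_relations [Algebra ℂ R] {k e f S x W T V F : R}
    (hke : k * e - e * k = e) (hkf : k * f - f * k = -f) (hef : e * f + f * e = -k)
    (hx : ∀ a, x * a = a * x) (hS : S * S = 1 + x * e ^ 2 * (x * e ^ 2)) (hSunit : IsUnit S)
    (hScomm : ∀ a, e ^ 2 * a = a * e ^ 2 → S * a = a * S)
    (hT : T = x * e ^ 2 + S) (hV : V = -(x * e ^ 2) + S)
    (hW : (T + 1) * W = 1) (hW' : W * (T + 1) = 1)
    (hF : F = f + (1 / 4 : ℂ) • (x * ((T - 1) * W * e)) -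
      (1 / 2 : ℂ) • (x * ((T - 1) * W * (e * k)))) :
    S * k * e - e * (S * k) = (1 / 2 : ℂ) • ((T + V) * e) ∧
    S * k * F - F * (S * k) = -((1 / 4 : ℂ) • ((T + V) * F)) - (1 / 4 : ℂ) • (F * (T + V)) ∧
    e * F + F * e = -(S * k) ∧
    S * k * T - T * (S * k) = T ^ 2 - 1 ∧
    S * k * V - V * (S * k) = V ^ 2 - 1 ∧
    (2 : ℂ) • (x * e ^ 2) = T - V ∧
    T * F - F * T = x * (T * e) ∧
    V * F - F * V = -(x * (V * e)) := by
  have h2 : IsUnit (2 : R) := by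
    simpa only [map_ofNat] using (IsUnit.mk0 (2 : ℂ) two_ne_zero).map (algebraMap ℂ R)
  have hSe : S * e = e * S := hScomm e (by noncomm_ring)
  have hku : k * e ^ 2 - e ^ 2 * k = 2 * e ^ 2 := by
    linear_combination (norm := noncomm_ring) hke * e + e * hke
  have huf : e ^ 2 * f - f * e ^ 2 = e := by
    linear_combination (norm := noncomm_ring) e * hef - hef * e + hke
  have hSx := hx S
  obtain ⟨g, hg⟩ : ∃ g, g = x * e ^ 2 := ⟨_, rfl⟩
  rw [← hg] at hS hT hV
  have hge : g * e = e * g := by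
    rw [hg]; linear_combination (norm := noncomm_ring) hx e * e ^ 2
  have hSg : S * g = g * S := by
    rw [hg]; linear_combination (norm := noncomm_ring) -hSx * e ^ 2 + x * hSe * e + x * e * hSe
  have hkg : k * g - g * k = 2 * g := by
    rw [hg]; linear_combination (norm := noncomm_ring) -hx k * e ^ 2 + x * hku
  have hfg : f * g - g * f = -(x * e) := by
    rw [hg]; linear_combination (norm := noncomm_ring) -hx f * e ^ 2 - x * huf
  have hSu : S * e ^ 2 = e ^ 2 * S := by
    linear_combination (norm := noncomm_ring) hSe * e + e * hSe
  have hkS : S * (k * S - S * k) = g * (2 * g) :=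
    mul_commutator_of_sq_eq h2 hS hkg (by noncomm_ring) <| hScomm _ <| by
      linear_combination (norm := noncomm_ring)
        -hku * S + S * hku + 2 * hSu - k * hSu + hSu * k
  have hfS : S * (f * S - S * f) = g * -(x * e) :=
    mul_commutator_of_sq_eq h2 hS hfg
      (by linear_combination (norm := noncomm_ring) hx g * e - x * hge) <| hScomm _ <| by
      linear_combination (norm := noncomm_ring)
        huf * S - S * huf - hSe - f * hSu + hSu * f
  have hT' : T = S + g := by rw [hT, add_comm]
  have hTT : T * T - 1 = 2 * (g * T) := by
    rw [hT']; linear_combination (norm := noncomm_ring) hS + hSg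
  have hTV : T * V = 1 := by
    rw [hT, hV]; linear_combination (norm := noncomm_ring) hS - hSg
  have hVT : V * T = 1 := by
    rw [hT, hV]; linear_combination (norm := noncomm_ring) hS + hSg
  have hkT : S * (k * T - T * k) = T * T - 1 := by
    rw [hTT, hT']; linear_combination (norm := noncomm_ring) hkS + S * hkg + 2 * hSg
  have hfT : S * (T * f - f * T) = x * (e * T) := by
    rw [hT']
    linear_combination (norm := noncomm_ring)
      -hfS - S * hfg - hSx * e + x * hSe - hx g * e + x * hge
  have hST : S * T = T * S := by
    rw [hT']; linear_combination (norm := noncomm_ring) hSg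
  have hW1 : (S + g + 1) * W = 1 := by rw [← hT', hW]
  have hgY := mul_cayley hS hSg hW1
  have hYq := one_add_mul_cayley hS hSg hW1
  have hkY := mul_commutator_cayley hST hW hW' hkT
  rw [← hT'] at hgY hYq
  have hcomm_Y {a : R} (h : a * T = T * a) : a * ((T - 1) * W) = (T - 1) * W * a := by
    have := mul_comm_of_inverse (a := a) (b := T + 1) (by linear_combination (norm := noncomm_ring) h) hW hW'
    linear_combination (norm := noncomm_ring) h * W + (T - 1) * this
  have hSY := hcomm_Y hST
  have hgY' : g * ((T - 1) * W) = (T - 1) * W * g :=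
    hcomm_Y (by rw [hT']; linear_combination (norm := noncomm_ring) -hSg)
  have heY : e * ((T - 1) * W) = (T - 1) * W * e :=
    hcomm_Y (by rw [hT']; linear_combination (norm := noncomm_ring) -hSe - hge)
  obtain ⟨Y, hY⟩ : ∃ Y, Y = (T - 1) * W := ⟨_, rfl⟩
  rw [← hY] at hgY hYq hkY hSY hgY' heY hF
  obtain ⟨p, hp4⟩ : ∃ p : R, p = (1 / 4 : ℂ) • x := ⟨_, rfl⟩
  have hp (a : R) : p * a = a * p := by
    rw [hp4, smul_mul_assoc, mul_smul_comm, hx]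
  have hxp : x = 4 * p := by
    rw [hp4, ← map_ofNat (algebraMap ℂ R) 4, ← Algebra.smul_def, smul_smul]; norm_num
  have hF' : F = f + p * Y * e - 2 * (p * Y * e * k) := by
    have : (1 / 2 : ℂ) • x = 2 * p := by
      rw [hp4, two_mul, ← add_smul]; norm_num
    rw [hF, ← smul_mul_assoc, ← smul_mul_assoc, ← hp4, this]
    noncomm_ring
  have hTF : T * F - F * T = x * (T * e) := by
    rw [hF']
    refine commutator_deformed_group hSunit hT' hSe hge hSx ?_ ?_ ?_ hkT hfT hTT
    · linear_combination (norm := noncomm_ring) p * hSY - hp S * Y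
    · linear_combination (norm := noncomm_ring) p * hgY' - hp g * Y
    · rw [hxp]; linear_combination (norm := noncomm_ring) 4 * p * hgY - 4 * p * hgY'
  have hVF : V * F - F * V = -(x * (V * e)) := by
    have hVe : V * e = e * V := by
      rw [hV]; linear_combination (norm := noncomm_ring) hSe - hge
    linear_combination (norm := noncomm_ring) -V * hTF * V + hVT * (F * V) - V * F * hTV
      + hx V * T * e * V - x * hVT * e * V + x * hVe
  have hTV2 : T + V = (2 : ℂ) • S := by
    rw [hT, hV, two_smul]; abel
  have hSF : S * F - F * S = 4 * (p * g * e) := by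
    apply h2.mul_left_cancel
    have hS2 : 2 * S = T + V := by rw [hT, hV]; noncomm_ring
    have hg2 : T - V = 2 * g := by rw [hT, hV]; noncomm_ring
    linear_combination (norm := noncomm_ring)
      hS2 * F - F * hS2 + hTF + hVF + x * hg2 * e + 2 * hxp * g * e
  have hcartan := commutator_deformed_cartan (S := S) (q := p * g) hkf hke hF'
    (by linear_combination (norm := noncomm_ring) p * hYq - hp S * Y)
    (by
      linear_combination (norm := noncomm_ring)
        p * hkY - hp S * (k * Y - Y * k) - S * hp k * Y)
    hSF
  refine ⟨?_, ?_, ?_, ?_, ?_, ?_, hTF, hVF⟩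
  · rw [hTV2, smul_mul_assoc, smul_smul]
    norm_num
    linear_combination (norm := noncomm_ring) S * hke + hSe * k
  · have h : S * k * F - F * (S * k) = (1 / 2 : ℂ) • (2 * (S * k * F - F * (S * k))) := by
      rw [two_mul, ← two_smul ℂ, smul_smul]; norm_num
    rw [h, hcartan, hTV2]
    simp only [smul_mul_assoc, mul_smul_comm]
    module
  · rw [hF']
    refine anticommutator_deformed hke hef ?_ ?_
    · linear_combination (norm := noncomm_ring) -p * heY + hp e * Y
    · have : 4 * (p * e ^ 2) = g := by rw [hg, hxp]; noncomm_ring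
      linear_combination (norm := noncomm_ring) hgY - hgY' + 4 * hp Y * e ^ 2 + Y * this
  · linear_combination (norm := noncomm_ring) hkT + hST * k
  · rw [hV]
    linear_combination (norm := noncomm_ring) hkS - S * hkg - hS - hSg - hSg * k
  · rw [← hg, hT, hV, two_smul]; abel

end RingLemmas

/-- In `R = A[[h]]`, with `b₊ := e²`, `S`, `T`, `T⁻¹` as above (for `u = b₊`),
`E := e`, `H := S·h̄` and `F := f + (h/4)(T-1)(T+1)⁻¹e - (h/2)(T-1)(T+1)⁻¹e·h̄`
(`W` being the two-sided inverse of `T+1` in `R`), the super-Jordanian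
`U_h(osp(1|2))` relations hold.  Here `A` is any unital associative `ℂ`-algebra
containing elements `h̄, e, f` with the `osp(1|2)` relations. -/
theorem statement_13 (A : Type*) [Ring A] [Algebra ℂ A] (hb e f : A)
    (rel1 : hb * e - e * hb = e)
    (rel2 : hb * f - f * hb = -f)
    (rel3 : e * f + f * e = -hb)
    (W : PowerSeries A)
    (hW : (Tser (e ^ 2) + 1) * W = 1)
    (hW' : W * (Tser (e ^ 2) + 1) = 1) :
    ∀ E H F T Tinv : PowerSeries A,
      E = PowerSeries.C e →
      H = sqrtSer (e ^ 2) * PowerSeries.C hb →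
      T = Tser (e ^ 2) →
      Tinv = Tinvser (e ^ 2) →
      F = PowerSeries.C f +
            (1/4 : ℂ) • (PowerSeries.X * ((T - 1) * W * PowerSeries.C e)) -
            (1/2 : ℂ) • (PowerSeries.X * ((T - 1) * W * PowerSeries.C (e * hb))) →
      (H * E - E * H = (1/2 : ℂ) • ((T + Tinv) * E) ∧
       H * F - F * H =
         -((1/4 : ℂ) • ((T + Tinv) * F)) - (1/4 : ℂ) • (F * (T + Tinv)) ∧
       E * F + F * E = -H ∧
       H * T - T * H = T ^ 2 - 1 ∧
       H * Tinv - Tinv * H = Tinv ^ 2 - 1 ∧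
       (2 : ℂ) • (PowerSeries.X * E ^ 2) = T - Tinv ∧
       T * F - F * T = PowerSeries.X * (T * E) ∧
       Tinv * F - F * Tinv = -(PowerSeries.X * (Tinv * E))) := by
  rintro E H F T Tinv rfl rfl rfl rfl rfl
  have key := superJordanian_relations (k := PowerSeries.C hb) (e := PowerSeries.C e)
    (f := PowerSeries.C f) (x := PowerSeries.X) (S := sqrtSer (e ^ 2)) (T := Tser (e ^ 2))
    (V := Tinvser (e ^ 2)) (by simp only [← map_mul, ← map_sub, rel1])
    (by simp only [← map_mul, ← map_sub, ← map_neg, rel2])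
    (by simp only [← map_mul, ← map_add, ← map_neg, rel3])
    (fun _ => PowerSeries.X_mul) (by rw [← map_pow, sqrtSer_mul_self]) (isUnit_sqrtSer _)
    (fun a ha => (commute_sqrtSer (by rwa [map_pow])).eq)
    (by rw [← map_pow, Tser]) (by rw [← map_pow, Tinvser]) hW hW' rfl
  simpa only [map_mul] using key
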